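/- arXiv:1411.1355 — 2 statements merged into one kernel-verified Lean document; each statement's English description precedes it below -/
import Mathlib

section
/- There exist r > 0 and constants C₁, C₂ > 0, depending only on f, such that C₁|y| ≤ |y*(y)| ≤ C₂|y| for all y ∈ B_r(0). -/
open Real

noncomputable section

/-- The point `(a, b)` of the Euclidean plane. -/
def pt (a b : ℝ) : EuclideanSpace ℝ (Fin 2) := (WithLp.equiv 2 (Fin 2 → ℝ)).symm ![a, b]

theorem norm_le_abs_add_abs (z : EuclideanSpace ℝ (Fin 2)) : ‖z‖ ≤ |z 0| + |z 1| := by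
  refine le_of_sq_le_sq ?_ (by positivity)
  rw [EuclideanSpace.norm_sq_eq, Fin.sum_univ_two, Real.norm_eq_abs, Real.norm_eq_abs]
  nlinarith [abs_nonneg (z 0), abs_nonneg (z 1)]

@[simp]
theorem pt_apply_zero (a b : ℝ) : pt a b 0 = a := rfl

@[simp]
theorem pt_apply_one (a b : ℝ) : pt a b 1 = b := rfl

theorem norm_pt_neg (y : EuclideanSpace ℝ (Fin 2)) : ‖pt (y 0) (-(y 1))‖ = ‖y‖ := by
  simp [EuclideanSpace.norm_eq, Fin.sum_univ_two]

/-- A `C¹` function vanishing to first order at the origin is small there, as is its derivative. -/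
theorem eventually_abs_le_and_abs_deriv_le {f : ℝ → ℝ} (hf : ContDiff ℝ 1 f) (hf0 : f 0 = 0)
    (hf'0 : deriv f 0 = 0) {ε : ℝ} (hε : 0 < ε) :
    ∀ᶠ s in nhds (0 : ℝ), |f s| ≤ ε * |s| ∧ |deriv f s| ≤ ε := by
  have hd : HasDerivAt f 0 0 := by
    simpa [hf'0] using (hf.differentiable one_ne_zero 0).hasDerivAt
  have h1 := (hasDerivAt_iff_isLittleO.mp hd).def hε
  have hc : Continuous (deriv f) := hf.continuous_deriv le_rfl
  have h2 : ∀ᶠ s in nhds (0 : ℝ), |deriv f s| < ε :=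
    hc.abs.continuousAt.eventually_lt continuousAt_const (by simpa [hf'0] using hε)
  filter_upwards [h1, h2] with s h1 h2
  exact ⟨by simpa [hf0] using h1, h2.le⟩

/-- **Comparability of `|y*|` and `|y|`.**
With `f`, the implicit map `S` of Lemma 1 (defined on a ball of radius `r₀`),
`e(y) = (S y, f (S y))` and `y*(y) = 2 e(y) − y`: there exist `r > 0` and
constants `C₁, C₂ > 0`, depending only on `f`, such that
`C₁ |y| ≤ |y*(y)| ≤ C₂ |y|` for all `y ∈ B_r(0)`. -/
theorem reflection_norm_comparable
    (f : ℝ → ℝ) (hf : ContDiff ℝ 3 f) (hf0 : f 0 = 0) (hf'0 : deriv f 0 = 0)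
    (r₀ : ℝ) (hr₀ : 0 < r₀) (S : EuclideanSpace ℝ (Fin 2) → ℝ)
    (hS : ∀ y ∈ Metric.ball (0 : EuclideanSpace ℝ (Fin 2)) r₀,
        S y ∈ Set.Ioo (-(2 * r₀)) (2 * r₀) ∧
        (S y - y 0) + deriv f (S y) * (f (S y) - y 1) = 0 ∧
        ∀ s ∈ Set.Ioo (-(2 * r₀)) (2 * r₀),
          (s - y 0) + deriv f s * (f s - y 1) = 0 → s = S y)
    (hS2 : ContDiffOn ℝ 2 S (Metric.ball 0 r₀))
    (ystar : EuclideanSpace ℝ (Fin 2) → EuclideanSpace ℝ (Fin 2))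
    (hystar : ∀ y, ystar y = (2 : ℝ) • pt (S y) (f (S y)) - y) :
    ∃ r C₁ C₂ : ℝ, 0 < r ∧ r ≤ r₀ ∧ 0 < C₁ ∧ 0 < C₂ ∧
      ∀ y ∈ Metric.ball (0 : EuclideanSpace ℝ (Fin 2)) r,
        C₁ * ‖y‖ ≤ ‖ystar y‖ ∧ ‖ystar y‖ ≤ C₂ * ‖y‖ := by
  have h0 : S 0 = 0 :=
    ((hS 0 (Metric.mem_ball_self hr₀)).2.2 0 ⟨by linarith, by linarith⟩ (by simp [hf'0])).symm
  have hcS : ContinuousAt S 0 := hS2.continuousOn.continuousAt (Metric.ball_mem_nhds 0 hr₀)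
  have hsmall := eventually_abs_le_and_abs_deriv_le (hf.of_le (by norm_num)) hf0 hf'0
    (ε := 1 / 8) (by norm_num)
  have hev : ∀ᶠ y in nhds (0 : EuclideanSpace ℝ (Fin 2)),
      |f (S y)| ≤ 1 / 8 * |S y| ∧ |deriv f (S y)| ≤ 1 / 8 :=
    hcS.eventually (by rwa [h0])
  obtain ⟨δ, hδ, hball⟩ := Metric.eventually_nhds_iff_ball.mp hev
  refine ⟨min δ r₀, 1 / 4, 2, lt_min hδ hr₀, min_le_right _ _, by norm_num, by norm_num, ?_⟩
  intro y hy
  obtain ⟨hfS, hdS⟩ := hball y (Metric.ball_subset_ball (min_le_left _ _) hy)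
  have heq := (hS y (Metric.ball_subset_ball (min_le_right _ _) hy)).2.1
  have hy0 : |y 0| ≤ ‖y‖ := PiLp.norm_apply_le y 0
  have hy1 : |y 1| ≤ ‖y‖ := PiLp.norm_apply_le y 1
  have hdist : |S y - y 0| ≤ 1 / 8 * (1 / 8 * |S y| + |y 1|) := by
    rw [eq_neg_of_add_eq_zero_left heq, abs_neg, abs_mul]
    gcongr
    exact (abs_sub _ _).trans (by gcongr)
  have hSy : |S y| ≤ |S y - y 0| + |y 0| := by
    simpa using abs_add_le (S y - y 0) (y 0)
  have hdiff : ‖ystar y - pt (y 0) (-(y 1))‖ ≤ 2 * |S y - y 0| + 2 * |f (S y)| := by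
    refine (norm_le_abs_add_abs _).trans_eq ?_
    have e0 : (ystar y - pt (y 0) (-(y 1))) 0 = 2 * (S y - y 0) := by
      simp [hystar]; ring
    have e1 : (ystar y - pt (y 0) (-(y 1))) 1 = 2 * f (S y) := by
      simp [hystar]
    rw [e0, e1, abs_mul, abs_mul, abs_two]
  have hlow := norm_sub_norm_le (pt (y 0) (-(y 1))) (ystar y)
  have hupp := norm_sub_norm_le (ystar y) (pt (y 0) (-(y 1)))
  rw [norm_sub_rev] at hlow
  rw [norm_pt_neg] at hlow hupp
  constructor <;> linarith [norm_nonneg y]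
end
end

section
/- There exist r > 0 and C > 0, depending only on f, such that for all s with |s| ≤ r and all y ∈ B_r(0) with y₂ > f(y₁) and y ≠ (s, f(s)), writing x = (s, f(s)), the third derivative in s of the function s ↦ log|(s, f(s)) − y| − log|(s, f(s)) − y*(y)| is bounded in absolute value by C/|x − y|². -/
open Real

noncomputable section

lemma norm_pt_sub_sq (a b : ℝ) (y : EuclideanSpace ℝ (Fin 2)) :
    ‖pt a b - y‖ ^ 2 = (a - y 0) ^ 2 + (b - y 1) ^ 2 := by
  rw [EuclideanSpace.norm_sq_eq]
  simp [pt, Fin.sum_univ_two]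

lemma log_norm_pt_sub (a b : ℝ) (y : EuclideanSpace ℝ (Fin 2)) :
    Real.log ‖pt a b - y‖ = 1 / 2 * Real.log ((a - y 0) ^ 2 + (b - y 1) ^ 2) := by
  rw [← norm_pt_sub_sq, Real.log_pow]
  push_cast
  ring

/-- The third derivative of `log P` expressed through the first three derivatives of `P`. -/
lemma iteratedDeriv_three_log {P P₁ P₂ : ℝ → ℝ} {c s : ℝ}
    (h₀ : ∀ t, HasDerivAt P (P₁ t) t) (h₁ : ∀ t, HasDerivAt P₁ (P₂ t) t)
    (h₂ : HasDerivAt P₂ c s) (hs : P s ≠ 0) :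
    iteratedDeriv 3 (fun t => Real.log (P t)) s =
      c / P s - 3 * P₁ s * P₂ s / P s ^ 2 + 2 * P₁ s ^ 3 / P s ^ 3 := by
  have hne : ∀ᶠ t in nhds s, P t ≠ 0 := (h₀ s).continuousAt.eventually_ne hs
  have e₁ : deriv (fun t => Real.log (P t)) =ᶠ[nhds s] fun t => P₁ t / P t := by
    filter_upwards [hne] with t ht
    exact ((h₀ t).log ht).deriv
  have e₂ : deriv (deriv (fun t => Real.log (P t))) =ᶠ[nhds s]
      fun t => (P₂ t * P t - P₁ t * P₁ t) / P t ^ 2 := by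
    refine e₁.deriv.trans ?_
    filter_upwards [hne] with t ht
    exact ((h₁ t).div (h₀ t) ht).deriv
  rw [iteratedDeriv_succ, iteratedDeriv_succ, iteratedDeriv_one, e₂.deriv_eq]
  have h := ((h₂.mul (h₀ s)).sub ((h₁ s).mul (h₁ s))).div ((h₀ s).pow 2) (pow_ne_zero 2 hs)
  refine h.deriv.trans ?_
  simp only [Pi.mul_apply, Pi.sub_apply, Pi.pow_apply]
  field_simp
  push_cast
  ring

/-- The third derivative in `t` of `log ((t - b) ^ 2 + (f t - d) ^ 2)`. -/
lemma iteratedDeriv_three_log_dist {f f₁ f₂ f₃ : ℝ → ℝ} (h₁ : ∀ t, HasDerivAt f (f₁ t) t)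
    (h₂ : ∀ t, HasDerivAt f₁ (f₂ t) t) (h₃ : ∀ t, HasDerivAt f₂ (f₃ t) t) (b d s : ℝ)
    (hs : (s - b) ^ 2 + (f s - d) ^ 2 ≠ 0) :
    iteratedDeriv 3 (fun t => Real.log ((t - b) ^ 2 + (f t - d) ^ 2)) s =
      (6 * f₁ s * f₂ s + 2 * (f s - d) * f₃ s) / ((s - b) ^ 2 + (f s - d) ^ 2)
      - 3 * (2 * (s - b) + 2 * (f s - d) * f₁ s) * (2 + 2 * f₁ s ^ 2 + 2 * (f s - d) * f₂ s)
        / ((s - b) ^ 2 + (f s - d) ^ 2) ^ 2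
      + 2 * (2 * (s - b) + 2 * (f s - d) * f₁ s) ^ 3 / ((s - b) ^ 2 + (f s - d) ^ 2) ^ 3 := by
  refine iteratedDeriv_three_log (P := fun t => (t - b) ^ 2 + (f t - d) ^ 2)
    (P₁ := fun t => 2 * (t - b) + 2 * (f t - d) * f₁ t)
    (P₂ := fun t => 2 + 2 * f₁ t ^ 2 + 2 * (f t - d) * f₂ t) (fun t => ?_) (fun t => ?_) ?_ hs
  · refine ((((hasDerivAt_id t).sub_const b).pow 2).add
      (((h₁ t).sub_const d).pow 2)).congr_deriv ?_
    simp
  · refine ((((hasDerivAt_id t).sub_const b).const_mul 2).add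
      ((((h₁ t).sub_const d).const_mul 2).mul (h₂ t))).congr_deriv ?_
    ring
  · refine (((((h₂ s).pow 2).const_mul 2).const_add 2).add
      ((((h₁ s).sub_const d).const_mul 2).mul (h₃ s))).congr_deriv ?_
    push_cast
    ring

lemma abs_mul_sub_mul_le {a b c d A B D E : ℝ} (hb : |b| ≤ B) (hc : |c| ≤ A)
    (hac : |a - c| ≤ D) (hbd : |b - d| ≤ E) : |a * b - c * d| ≤ D * B + A * E := by
  have h : a * b - c * d = (a - c) * b + c * (b - d) := by ring
  rw [h]
  refine (abs_add_le _ _).trans ?_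
  rw [abs_mul, abs_mul]
  have := abs_nonneg (a - c)
  have := abs_nonneg c
  have := abs_nonneg b
  have := abs_nonneg (b - d)
  gcongr <;> linarith

lemma abs_mul_le_mul {a b A B : ℝ} (ha : |a| ≤ A) (hb : |b| ≤ B) : |a * b| ≤ A * B := by
  rw [abs_mul]
  have := abs_nonneg a
  have := abs_nonneg b
  gcongr
  linarith

/-- Lipschitz estimate for the polynomial appearing in the third derivative of a logarithm. -/
lemma abs_log_polynomial_sub_le {K D x₁ x₂ x₃ z y₁ y₂ y₃ w : ℝ}
    (hx₁ : |x₁| ≤ K) (hx₂ : |x₂| ≤ K) (hz : |z| ≤ K)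
    (hy₁ : |y₁| ≤ K) (hy₂ : |y₂| ≤ K) (hy₃ : |y₃| ≤ K) (hw : |w| ≤ K)
    (h₁ : |x₁ - y₁| ≤ D) (h₂ : |x₂ - y₂| ≤ D) (h₃ : |x₃ - y₃| ≤ D) (hzw : |z - w| ≤ D) :
    |(x₃ * z - 3 * (x₁ * x₂ * (z * z)) + 2 * (x₁ * z * ((x₁ * z) * (x₁ * z))))
      - (y₃ * w - 3 * (y₁ * y₂ * (w * w)) + 2 * (y₁ * w * ((y₁ * w) * (y₁ * w))))|
      ≤ (2 * K + 12 * K ^ 3 + 12 * K ^ 5) * D := by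
  have b₁ := abs_mul_sub_mul_le hz hy₃ h₃ hzw
  have b₂ := abs_mul_sub_mul_le (abs_mul_le_mul hz hz) (abs_mul_le_mul hy₁ hy₂)
    (abs_mul_sub_mul_le hx₂ hy₁ h₁ h₂) (abs_mul_sub_mul_le hz hw hzw hzw)
  have hxz := abs_mul_le_mul hx₁ hz
  have hyw := abs_mul_le_mul hy₁ hw
  have b₃ := abs_mul_sub_mul_le hz hy₁ h₁ hzw
  have b₄ := abs_mul_sub_mul_le (abs_mul_le_mul hxz hxz) hyw b₃
    (abs_mul_sub_mul_le hxz hyw b₃ b₃)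
  rw [abs_le] at b₁ b₂ b₄ ⊢
  constructor <;> linarith [b₁.1, b₁.2, b₂.1, b₂.2, b₄.1, b₄.2]

/-- Comparison of the third derivatives of `log P` and `log Q` when the jets of `P` and `Q` have
the size of the jet of a squared distance `ρ ^ 2` and agree up to one more order in `ρ`. -/
lemma abs_log_third_sub_le {K ρ P P₁ P₂ P₃ Q Q₁ Q₂ Q₃ : ℝ} (hK : 2 ≤ K) (hρ : 0 < ρ) (hρ1 : ρ ≤ 1)
    (hP : ρ ^ 2 / 2 ≤ P) (hQ : ρ ^ 2 / 2 ≤ Q)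
    (hP₁ : |P₁| ≤ K * ρ) (hP₂ : |P₂| ≤ K)
    (hQ₁ : |Q₁| ≤ K * ρ) (hQ₂ : |Q₂| ≤ K) (hQ₃ : |Q₃| ≤ K)
    (h₀ : |P - Q| ≤ K * ρ ^ 3) (h₁ : |P₁ - Q₁| ≤ K * ρ ^ 2) (h₂ : |P₂ - Q₂| ≤ K * ρ)
    (h₃ : |P₃ - Q₃| ≤ K) :
    |(P₃ / P - 3 * P₁ * P₂ / P ^ 2 + 2 * P₁ ^ 3 / P ^ 3)
      - (Q₃ / Q - 3 * Q₁ * Q₂ / Q ^ 2 + 2 * Q₁ ^ 3 / Q ^ 3)|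
      ≤ (2 * K + 12 * K ^ 3 + 12 * K ^ 5) * (4 * K) / ρ ^ 2 := by
  have hρ2 : 0 < ρ ^ 2 := by positivity
  have hP0 : 0 < P := by linarith
  have hQ0 : 0 < Q := by linarith
  have scale : ∀ {a c : ℝ} (n : ℕ), |a| ≤ c * ρ ^ n → |a / ρ ^ n| ≤ c := by
    intro a c n h
    rw [abs_div, abs_of_pos (pow_pos hρ n), div_le_iff₀ (pow_pos hρ n)]
    exact h
  have inv_le : ∀ {R : ℝ}, ρ ^ 2 / 2 ≤ R → |ρ ^ 2 / R| ≤ 2 := by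
    intro R hR
    have hR0 : 0 < R := by linarith
    rw [abs_of_pos (by positivity), div_le_iff₀ hR0]
    linarith
  have key := abs_log_polynomial_sub_le (K := K) (D := 4 * K * ρ) (x₁ := P₁ / ρ ^ 1) (x₂ := P₂)
    (x₃ := P₃ * ρ) (z := ρ ^ 2 / P) (y₁ := Q₁ / ρ ^ 1) (y₂ := Q₂) (y₃ := Q₃ * ρ) (w := ρ ^ 2 / Q)
    (scale 1 (by simpa using hP₁)) hP₂ ((inv_le hP).trans hK)
    (scale 1 (by simpa using hQ₁)) hQ₂
    (by simpa using abs_mul_le_mul hQ₃ (b := ρ) (B := 1) (by rwa [abs_of_pos hρ]))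
    ((inv_le hQ).trans hK) ?_ (h₂.trans (by nlinarith)) ?_ ?_
  · have hL : ∀ R R₁ R₂ R₃ : ℝ, 0 < R → R₃ / R - 3 * R₁ * R₂ / R ^ 2 + 2 * R₁ ^ 3 / R ^ 3 =
        (R₃ * ρ * (ρ ^ 2 / R) - 3 * (R₁ / ρ ^ 1 * R₂ * (ρ ^ 2 / R * (ρ ^ 2 / R)))
          + 2 * (R₁ / ρ ^ 1 * (ρ ^ 2 / R) * ((R₁ / ρ ^ 1 * (ρ ^ 2 / R))
            * (R₁ / ρ ^ 1 * (ρ ^ 2 / R))))) / ρ ^ 3 := by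
      intro R R₁ R₂ R₃ hR
      field_simp
    rw [hL P P₁ P₂ P₃ hP0, hL Q Q₁ Q₂ Q₃ hQ0, ← sub_div, abs_div, abs_of_pos (pow_pos hρ 3),
      div_le_iff₀ (pow_pos hρ 3)]
    refine key.trans (le_of_eq ?_)
    field_simp
  · rw [← sub_div]
    refine scale 1 (h₁.trans ?_)
    nlinarith
  · rw [← sub_mul]
    refine (abs_mul_le_mul h₃ (le_of_eq (abs_of_pos hρ))).trans ?_
    nlinarith
  · have hd : ρ ^ 2 / P - ρ ^ 2 / Q = -(ρ ^ 2 / P * (ρ ^ 2 / Q) * ((P - Q) / ρ ^ 2)) := by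
      field_simp
      ring
    rw [hd, abs_neg]
    have h₀' : |(P - Q) / ρ ^ 2| ≤ K * ρ := scale 2 (h₀.trans (le_of_eq (by ring)))
    refine (abs_mul_le_mul (abs_mul_le_mul (inv_le hP) (inv_le hQ)) h₀').trans (le_of_eq ?_)
    ring

/-- Sizes of the first three derivatives, at a point of a curve, of the squared distance to the
point at signed normal height `k`; here `u` is the parameter distance, `p` the slope at the foot
point, `g`, `h` the first-order Taylor remainders of the curve and its slope, and `m`, `n` the
second and third derivatives of the curve. -/
lemma sq_dist_jet_bounds {M ρ u k p g h m n : ℝ} (hM : 1 ≤ M) (hρ : 0 ≤ ρ) (hρ1 : ρ ≤ 1)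
    (hu : |u| ≤ ρ) (hk : |k| ≤ ρ) (hsq : u ^ 2 + k ^ 2 = ρ ^ 2) (hsmall : M * (|u| + |k|) ≤ 1 / 4)
    (hp : |p| ≤ 1) (hg : |g| ≤ M * u ^ 2) (hh : |h| ≤ M * |u|) (hm : |m| ≤ M) (hn : |n| ≤ M) :
    ρ ^ 2 / 2 ≤ (u + p * k) ^ 2 + (p * u + g - k) ^ 2 ∧
    (u + p * k) ^ 2 + (p * u + g - k) ^ 2 ≤ 20 * M * ρ ^ 2 ∧
    |2 * (u + p * k) + 2 * (p * u + g - k) * (p + h)| ≤ 20 * M * ρ ∧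
    |2 + 2 * (p + h) ^ 2 + 2 * (p * u + g - k) * m| ≤ 20 * M ∧
    |6 * (p + h) * m + 2 * (p * u + g - k) * n| ≤ 20 * M := by
  have hpu : |p * u| ≤ |u| := by simpa using abs_mul_le_mul hp (le_refl |u|)
  have hpk : |p * k| ≤ |k| := by simpa using abs_mul_le_mul hp (le_refl |k|)
  have hMu : M * |u| ≤ 1 / 4 := by nlinarith [abs_nonneg k]
  have hgu : |g| ≤ ρ := by
    have : M * u ^ 2 = M * |u| * |u| := by rw [← sq_abs]; ring
    nlinarith [abs_nonneg u]
  have hh1 : |p + h| ≤ 2 := (abs_add_le _ _).trans (by linarith)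
  have hα : |u + p * k| ≤ 2 * ρ := (abs_add_le _ _).trans (by linarith)
  have hβ : |p * u + g - k| ≤ 3 * ρ :=
    (abs_sub _ _).trans (by linarith [abs_add_le (p * u) g])
  have hβ' : |p * u - k| ≤ |u| + |k| := (abs_sub _ _).trans (by linarith)
  have hρM : ρ ≤ M * ρ := by nlinarith
  have hMρ : M * ρ ≤ M := by nlinarith
  refine ⟨?_, ?_, ?_, ?_, ?_⟩
  · have h1 := abs_mul_le_mul hg hβ'
    have h2 : M * u ^ 2 * (|u| + |k|) ≤ u ^ 2 / 4 := by nlinarith [sq_nonneg u]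
    have h3 := (abs_le.1 (h1.trans h2)).1
    nlinarith [sq_nonneg g, sq_nonneg k, sq_nonneg (p * u), sq_nonneg (p * k)]
  · have h1 := sq_le_sq' (abs_le.1 hα).1 (abs_le.1 hα).2
    have h2 := sq_le_sq' (abs_le.1 hβ).1 (abs_le.1 hβ).2
    nlinarith [sq_nonneg ρ]
  · have h1 := abs_mul_le_mul hβ hh1
    refine (abs_add_le _ _).trans ?_
    rw [mul_assoc, abs_mul, abs_mul 2 (_ * _), abs_two]
    linarith
  · have h1 := abs_mul_le_mul hβ hm
    have h2 := sq_le_sq' (abs_le.1 hh1).1 (abs_le.1 hh1).2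
    rw [abs_le] at h1 ⊢
    constructor <;> nlinarith [sq_nonneg (p + h)]
  · have h1 := abs_mul_le_mul hβ hn
    have h2 := abs_mul_le_mul hh1 hm
    rw [abs_le] at h1 h2 ⊢
    constructor <;> linarith [h1.1, h1.2, h2.1, h2.2]

/-- Comparison of the third derivatives of the logarithms of the squared distances to the points
at signed normal heights `k` and `-k`, in the notation of `sq_dist_jet_bounds`. -/
lemma abs_log_third_sq_dist_sub_le {M ρ u k p g h m n : ℝ} (hM : 1 ≤ M) (hρ : 0 < ρ) (hρ1 : ρ ≤ 1)
    (hu : |u| ≤ ρ) (hk : |k| ≤ ρ) (hsq : u ^ 2 + k ^ 2 = ρ ^ 2) (hsmall : M * (|u| + |k|) ≤ 1 / 4)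
    (hp : |p| ≤ 1) (hg : |g| ≤ M * u ^ 2) (hh : |h| ≤ M * |u|) (hm : |m| ≤ M) (hn : |n| ≤ M) :
    |((6 * (p + h) * m + 2 * (p * u + g - k) * n)
          / ((u + p * k) ^ 2 + (p * u + g - k) ^ 2)
        - 3 * (2 * (u + p * k) + 2 * (p * u + g - k) * (p + h))
            * (2 + 2 * (p + h) ^ 2 + 2 * (p * u + g - k) * m)
          / ((u + p * k) ^ 2 + (p * u + g - k) ^ 2) ^ 2
        + 2 * (2 * (u + p * k) + 2 * (p * u + g - k) * (p + h)) ^ 3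
          / ((u + p * k) ^ 2 + (p * u + g - k) ^ 2) ^ 3)
      - ((6 * (p + h) * m + 2 * (p * u + g - -k) * n)
          / ((u + p * -k) ^ 2 + (p * u + g - -k) ^ 2)
        - 3 * (2 * (u + p * -k) + 2 * (p * u + g - -k) * (p + h))
            * (2 + 2 * (p + h) ^ 2 + 2 * (p * u + g - -k) * m)
          / ((u + p * -k) ^ 2 + (p * u + g - -k) ^ 2) ^ 2
        + 2 * (2 * (u + p * -k) + 2 * (p * u + g - -k) * (p + h)) ^ 3
          / ((u + p * -k) ^ 2 + (p * u + g - -k) ^ 2) ^ 3)|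
      ≤ (2 * (20 * M) + 12 * (20 * M) ^ 3 + 12 * (20 * M) ^ 5) * (4 * (20 * M)) / ρ ^ 2 := by
  have hM0 : 0 < M := by linarith
  have hnk : |-k| = |k| := abs_neg k
  obtain ⟨P0, -, P1, P2, -⟩ := sq_dist_jet_bounds hM hρ.le hρ1 hu hk hsq hsmall hp hg hh hm hn
  obtain ⟨Q0, -, Q1, Q2, Q3⟩ := sq_dist_jet_bounds (k := -k) hM hρ.le hρ1 hu (by rwa [hnk])
    (by rwa [neg_sq]) (by rwa [hnk]) hp hg hh hm hn
  have hkg : |k * g| ≤ M * ρ ^ 3 :=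
    (abs_mul_le_mul hk (hg.trans (mul_le_mul_of_nonneg_left
      (by linarith [sq_nonneg k] : u ^ 2 ≤ ρ ^ 2) hM0.le))).trans (le_of_eq (by ring))
  have hkh : |k * h| ≤ M * ρ ^ 2 :=
    (abs_mul_le_mul hk (hh.trans (mul_le_mul_of_nonneg_left hu hM0.le))).trans
      (le_of_eq (by ring))
  have hkm : |k * m| ≤ M * ρ := (abs_mul_le_mul hk hm).trans (le_of_eq (by ring))
  have hkn : |k * n| ≤ M := (abs_mul_le_mul hk hn).trans (mul_le_of_le_one_left hM0.le hρ1)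
  have four : ∀ {x c e : ℝ}, |x| ≤ c → e = -4 * x → |e| ≤ 20 * c := by
    intro x c e hx he
    rw [he, abs_mul]
    norm_num
    linarith [abs_nonneg x]
  exact abs_log_third_sub_le (K := 20 * M) (by linarith) hρ hρ1 P0 Q0 P1 P2 Q1 Q2 Q3
    ((four hkg (by ring)).trans (le_of_eq (by ring)))
    ((four hkh (by ring)).trans (le_of_eq (by ring)))
    ((four hkm (by ring)).trans (le_of_eq (by ring)))
    (four hkn (by ring))

lemma half_div_le_mul_div {C L R P : ℝ} (hC : 0 ≤ C) (hR : 0 < R) (hP : 0 < P)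
    (hPR : P ≤ L * R) : 1 / 2 * (C / R) ≤ C * L / P := by
  rw [← mul_div_assoc, div_le_div_iff₀ hR hP]
  have h := mul_le_mul_of_nonneg_left hPR hC
  have h' := mul_nonneg hC hP.le
  linarith

/-- First-order Taylor estimate with a bounded second derivative. -/
lemma abs_taylor_one_le {f f₁ f₂ : ℝ → ℝ} (h₁ : ∀ t, HasDerivAt f (f₁ t) t)
    (h₂ : ∀ t, HasDerivAt f₁ (f₂ t) t) {M a s : ℝ} (hM : ∀ t ∈ Set.uIcc a s, |f₂ t| ≤ M) :
    |f₁ s - f₁ a| ≤ M * |s - a| ∧ |f s - f a - f₁ a * (s - a)| ≤ M * (s - a) ^ 2 := by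
  have hM0 : 0 ≤ M := (abs_nonneg _).trans (hM a Set.left_mem_uIcc)
  have hconv : Convex ℝ (Set.uIcc a s) := convex_uIcc a s
  have hf₁ : ∀ t ∈ Set.uIcc a s, |f₁ t - f₁ a| ≤ M * |t - a| := fun t ht =>
    hconv.norm_image_sub_le_of_norm_hasDerivWithin_le (fun x _ => (h₂ x).hasDerivWithinAt)
      hM Set.left_mem_uIcc ht
  refine ⟨hf₁ s Set.right_mem_uIcc, ?_⟩
  have h := hconv.norm_image_sub_le_of_norm_hasDerivWithin_le
    (f := fun t => f t - f₁ a * t) (f' := fun t => f₁ t - f₁ a) (C := M * |s - a|)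
    (fun x _ => (((h₁ x).sub ((hasDerivAt_id x).const_mul (f₁ a))).congr_deriv
      (by ring)).hasDerivWithinAt)
    (fun x hx => (hf₁ x hx).trans (by
      have := Set.abs_sub_left_of_mem_uIcc hx
      gcongr))
    Set.left_mem_uIcc Set.right_mem_uIcc
  simp only [Real.norm_eq_abs] at h
  rw [← sq_abs (s - a)]
  convert h using 1
  · congr 1
    ring
  · ring

set_option maxHeartbeats 400000 in
/-- **Third-derivative bound for the boundary kernel.**
With `f`, the implicit map `S` of Lemma 1 (on a ball of radius `r₀`) and the
reflection `y*(y) = 2 (S y, f (S y)) − y`: there exist `r > 0` and `C > 0`,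
depending only on `f`, such that for all `s` with `|s| ≤ r` and all
`y ∈ B_r(0)` with `y₂ > f y₁` and `y ≠ (s, f s)`, writing `x = (s, f s)`,
the third derivative in `s` of
`s ↦ log |(s, f s) − y| − log |(s, f s) − y*(y)|`
is bounded in absolute value by `C / |x − y|²`. -/
theorem boundary_kernel_third_derivative_bound
    (f : ℝ → ℝ) (hf : ContDiff ℝ 3 f) (hf0 : f 0 = 0) (hf'0 : deriv f 0 = 0)
    (r₀ : ℝ) (hr₀ : 0 < r₀) (S : EuclideanSpace ℝ (Fin 2) → ℝ)
    (hS : ∀ y ∈ Metric.ball (0 : EuclideanSpace ℝ (Fin 2)) r₀,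
        S y ∈ Set.Ioo (-(2 * r₀)) (2 * r₀) ∧
        (S y - y 0) + deriv f (S y) * (f (S y) - y 1) = 0 ∧
        ∀ s ∈ Set.Ioo (-(2 * r₀)) (2 * r₀),
          (s - y 0) + deriv f s * (f s - y 1) = 0 → s = S y)
    (hS2 : ContDiffOn ℝ 2 S (Metric.ball 0 r₀))
    (ystar : EuclideanSpace ℝ (Fin 2) → EuclideanSpace ℝ (Fin 2))
    (hystar : ∀ y, ystar y = (2 : ℝ) • pt (S y) (f (S y)) - y) :
    ∃ r C : ℝ, 0 < r ∧ r ≤ r₀ ∧ 0 < C ∧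
      ∀ s : ℝ, |s| ≤ r →
        ∀ y ∈ Metric.ball (0 : EuclideanSpace ℝ (Fin 2)) r,
          f (y 0) < y 1 → y ≠ pt s (f s) →
          |iteratedDeriv 3
              (fun t => Real.log ‖pt t (f t) - y‖ - Real.log ‖pt t (f t) - ystar y‖) s|
            ≤ C / ‖pt s (f s) - y‖ ^ 2 := by
  have hf1 : ContDiff ℝ 2 (deriv f) := ((contDiff_succ_iff_deriv (n := 2)).1 hf).2.2
  have hf2 : ContDiff ℝ 1 (deriv (deriv f)) := ((contDiff_succ_iff_deriv (n := 1)).1 hf1).2.2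
  have d₁ : ∀ t, HasDerivAt f (deriv f t) t := fun t =>
    (hf.differentiable (by norm_num) t).hasDerivAt
  have d₂ : ∀ t, HasDerivAt (deriv f) (deriv (deriv f) t) t := fun t =>
    (hf1.differentiable (by norm_num) t).hasDerivAt
  have d₃ : ∀ t, HasDerivAt (deriv (deriv f)) (deriv (deriv (deriv f)) t) t := fun t =>
    (hf2.differentiable (by norm_num) t).hasDerivAt
  have hc₃ : Continuous (deriv (deriv (deriv f))) := hf2.continuous_deriv (by norm_num)
  obtain ⟨M₂, hM₂⟩ := isCompact_Icc.exists_bound_of_continuousOn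
    (s := Set.Icc (-1 : ℝ) 1) hf2.continuous.continuousOn
  obtain ⟨M₃, hM₃⟩ := isCompact_Icc.exists_bound_of_continuousOn
    (s := Set.Icc (-1 : ℝ) 1) hc₃.continuousOn
  obtain ⟨M, hM, hMM₂, hMM₃⟩ : ∃ M : ℝ, 1 ≤ M ∧ M₂ ≤ M ∧ M₃ ≤ M :=
    ⟨max 1 (max M₂ M₃), by simp, by simp, by simp⟩
  have hM0 : 0 < M := by linarith
  obtain ⟨δ, hδ, hMδ⟩ : ∃ δ : ℝ, 0 < δ ∧ M * δ = 1 / 16 := ⟨1 / (16 * M), by positivity, by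
    field_simp⟩
  have hδ1 : δ ≤ 1 / 16 := by nlinarith
  have hball : Metric.ball (0 : EuclideanSpace ℝ (Fin 2)) r₀ ∈ nhds 0 := Metric.ball_mem_nhds _ hr₀
  have hS0 : S 0 = 0 := ((hS 0 (mem_of_mem_nhds hball)).2.2 0
    ⟨by linarith, by linarith⟩ (by simp [hf'0])).symm
  have hScont : ContinuousAt S 0 := hS2.continuousOn.continuousAt hball
  obtain ⟨r₁, hr₁, hSr⟩ := Metric.continuousAt_iff.1 hScont δ hδ
  refine ⟨min r₀ (min r₁ δ), (2 * (20 * M) + 12 * (20 * M) ^ 3 + 12 * (20 * M) ^ 5) *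
    (4 * (20 * M)) * (20 * M), by positivity, min_le_left _ _, by positivity, ?_⟩
  intro s hs y hy _ hne
  have hsδ : |s| ≤ δ := hs.trans ((min_le_right _ _).trans (min_le_right _ _))
  have hynorm : ‖y‖ < min r₀ (min r₁ δ) := by simpa using hy
  have hyr₀ : ‖y‖ < r₀ := hynorm.trans_le (min_le_left _ _)
  have hyr₁ : ‖y‖ < r₁ := hynorm.trans_le ((min_le_right _ _).trans (min_le_left _ _))
  have hyδ : ‖y‖ < δ := hynorm.trans_le ((min_le_right _ _).trans (min_le_right _ _))
  have hfoot := (hS y (by simpa using hyr₀)).2.1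
  have haδ : |S y| < δ := by
    simpa [hS0, Real.dist_eq] using hSr (x := y) (by simpa using hyr₁)
  have hy1 : |y 1| ≤ ‖y‖ := by simpa using PiLp.norm_apply_le y 1
  have hys0 : ystar y 0 = 2 * S y - y 0 := by simp [hystar, pt]
  have hys1 : ystar y 1 = 2 * f (S y) - y 1 := by simp [hystar, pt]
  obtain ⟨a, ha⟩ : ∃ a, S y = a := ⟨_, rfl⟩
  rw [ha] at hfoot haδ hys0 hys1
  obtain ⟨p, hp⟩ : ∃ p, deriv f a = p := ⟨_, rfl⟩
  obtain ⟨k, hk⟩ : ∃ k, y 1 - f a = k := ⟨_, rfl⟩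
  obtain ⟨u, hu⟩ : ∃ u, s - a = u := ⟨_, rfl⟩
  have hIcc : ∀ b c : ℝ, |b| ≤ δ → |c| ≤ δ → Set.uIcc b c ⊆ Set.Icc (-1) 1 := by
    intro b c hb hc
    rw [abs_le] at hb hc
    exact Set.uIcc_subset_Icc ⟨by linarith, by linarith⟩ ⟨by linarith, by linarith⟩
  have taylor : ∀ b c : ℝ, |b| ≤ δ → |c| ≤ δ → |deriv f c - deriv f b| ≤ M * |c - b| ∧
      |f c - f b - deriv f b * (c - b)| ≤ M * (c - b) ^ 2 := fun b c hb hc =>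
    abs_taylor_one_le d₁ d₂ fun t ht => (hM₂ t (hIcc b c hb hc ht)).trans hMM₂
  obtain ⟨ta₁, ta₂⟩ := taylor 0 a (by simpa using hδ.le) haδ.le
  obtain ⟨ts₁, ts₂⟩ := taylor a s haδ.le hsδ
  rw [hf'0, hp, sub_zero, sub_zero] at ta₁
  rw [hf0, hf'0, zero_mul, sub_zero, sub_zero, sub_zero] at ta₂
  rw [hp, hu] at ts₁ ts₂
  obtain ⟨h, hh⟩ : ∃ h, deriv f s - p = h := ⟨_, rfl⟩
  obtain ⟨g, hg⟩ : ∃ g, f s - f a - p * u = g := ⟨_, rfl⟩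
  rw [hh] at ts₁
  rw [hg] at ts₂
  have hsI : s ∈ Set.Icc (-1 : ℝ) 1 := hIcc a s haδ.le hsδ Set.right_mem_uIcc
  have hm : |deriv (deriv f) s| ≤ M := (hM₂ s hsI).trans hMM₂
  have hn : |deriv (deriv (deriv f)) s| ≤ M := (hM₃ s hsI).trans hMM₃
  obtain ⟨m, hm_def⟩ : ∃ m, deriv (deriv f) s = m := ⟨_, rfl⟩
  obtain ⟨n, hn_def⟩ : ∃ n, deriv (deriv (deriv f)) s = n := ⟨_, rfl⟩
  rw [hm_def] at hm
  rw [hn_def] at hn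
  have hp1 : |p| ≤ 1 :=
    ta₁.trans ((mul_le_mul_of_nonneg_left haδ.le hM0.le).trans (by linarith))
  have huδ : |u| ≤ 2 * δ := by
    rw [← hu]
    exact (abs_sub _ _).trans (by linarith)
  have hkδ : |k| ≤ 2 * δ := by
    have : M * a ^ 2 ≤ δ := by
      have h1 : M * |a| ≤ 1 := (mul_le_mul_of_nonneg_left haδ.le hM0.le).trans (by linarith)
      have h2 := mul_le_mul_of_nonneg_right h1 (abs_nonneg a)
      rw [← sq_abs, sq, ← mul_assoc]
      linarith
    rw [← hk]
    exact (abs_sub _ _).trans (by linarith)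
  have hsmall : M * (|u| + |k|) ≤ 1 / 4 :=
    (mul_le_mul_of_nonneg_left (add_le_add huδ hkδ) hM0.le).trans (by linarith)
  obtain ⟨ρ, hρ_def⟩ : ∃ ρ, √(u ^ 2 + k ^ 2) = ρ := ⟨_, rfl⟩
  have hρ0 : 0 ≤ ρ := hρ_def ▸ Real.sqrt_nonneg _
  have hsq : u ^ 2 + k ^ 2 = ρ ^ 2 := by
    rw [← hρ_def, Real.sq_sqrt (by positivity)]
  have hρ1 : ρ ≤ 1 := by
    have h1 := sq_le_sq' (abs_le.1 huδ).1 (abs_le.1 huδ).2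
    have h2 := sq_le_sq' (abs_le.1 hkδ).1 (abs_le.1 hkδ).2
    have h3 : (2 * δ) ^ 2 ≤ (1 / 8) ^ 2 := pow_le_pow_left₀ (by linarith) (by linarith) 2
    exact (sq_le_one_iff₀ hρ0).1 (by linarith)
  have huρ : |u| ≤ ρ := abs_le_of_sq_le_sq (by linarith [sq_nonneg k]) hρ0
  have hkρ : |k| ≤ ρ := abs_le_of_sq_le_sq (by linarith [sq_nonneg u]) hρ0
  have hy0 : s - y 0 = u + p * k := by
    rw [← hu, ← hk, ← hp]
    linarith
  have hy1' : f s - y 1 = p * u + g - k := by rw [← hg, ← hk]; ring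
  have hz0 : s - ystar y 0 = u + p * -k := by rw [hys0]; linarith
  have hz1 : f s - ystar y 1 = p * u + g - -k := by rw [hys1]; linarith
  have hq : deriv f s = p + h := by linarith
  have hρ : 0 < ρ := by
    refine hρ0.lt_of_ne fun h0 => hne ?_
    rw [← h0] at huρ hkρ
    have hu0 : u = 0 := abs_nonpos_iff.1 huρ
    have hk0 : k = 0 := abs_nonpos_iff.1 hkρ
    have hg0 : g = 0 := abs_nonpos_iff.1 (by simpa [hu0] using ts₂)
    rw [hu0, hk0] at hy0
    rw [hu0, hk0, hg0] at hy1'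
    have hnorm : ‖pt s (f s) - y‖ ^ 2 = 0 := by
      rw [norm_pt_sub_sq, hy0, hy1']
      ring
    exact (sub_eq_zero.1 (norm_eq_zero.1 (pow_eq_zero_iff two_ne_zero |>.1 hnorm))).symm
  have hnk : |-k| = |k| := abs_neg k
  obtain ⟨P0, P0', -⟩ := sq_dist_jet_bounds hM hρ0 hρ1 huρ hkρ hsq hsmall hp1 ts₂ ts₁ hm hn
  obtain ⟨Q0, -⟩ := sq_dist_jet_bounds (k := -k) hM hρ0 hρ1 huρ (by rwa [hnk])
    (by rwa [neg_sq]) (by rwa [hnk]) hp1 ts₂ ts₁ hm hn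
  have hρ2 : 0 < ρ ^ 2 := by positivity
  have hPne : (s - y 0) ^ 2 + (f s - y 1) ^ 2 ≠ 0 := by
    rw [hy0, hy1']
    linarith
  have hQne : (s - ystar y 0) ^ 2 + (f s - ystar y 1) ^ 2 ≠ 0 := by
    rw [hz0, hz1]
    linarith
  have hsmooth : ∀ b d : ℝ, (s - b) ^ 2 + (f s - d) ^ 2 ≠ 0 →
      ContDiffAt ℝ 3 (fun t => Real.log ((t - b) ^ 2 + (f t - d) ^ 2)) s := fun b d hbd =>
    ContDiffAt.log (by fun_prop) hbd
  have hD : iteratedDeriv 3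
      (fun t => Real.log ‖pt t (f t) - y‖ - Real.log ‖pt t (f t) - ystar y‖) s =
      1 / 2 * (iteratedDeriv 3 (fun t => Real.log ((t - y 0) ^ 2 + (f t - y 1) ^ 2)) s
        - iteratedDeriv 3
          (fun t => Real.log ((t - ystar y 0) ^ 2 + (f t - ystar y 1) ^ 2)) s) := by
    simp_rw [log_norm_pt_sub, ← mul_sub]
    rw [iteratedDeriv_const_mul_field, iteratedDeriv_fun_sub (hsmooth _ _ hPne) (hsmooth _ _ hQne)]
  rw [hD, iteratedDeriv_three_log_dist d₁ d₂ d₃ _ _ _ hPne,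
    iteratedDeriv_three_log_dist d₁ d₂ d₃ _ _ _ hQne, norm_pt_sub_sq, hy0, hy1', hz0, hz1, hq,
    hm_def, hn_def, abs_mul, abs_of_pos (by norm_num : (0 : ℝ) < 1 / 2)]
  exact (mul_le_mul_of_nonneg_left
    (abs_log_third_sq_dist_sub_le hM hρ hρ1 huρ hkρ hsq hsmall hp1 ts₂ ts₁ hm hn)
    (by norm_num)).trans (half_div_le_mul_div (by positivity) hρ2 (by linarith) P0')
end
end
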